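/- arXiv:2202.11344 — 3 statements merged into one kernel-verified Lean document; each statement's English description precedes it below -/
import Mathlib

section
/- Let q be a prime power, n, k > 0 integers, and R = A/t^kA. For every function φ : R^n → ℝ and every primitive vector w ∈ S^{n−1}(R), one has q^{−k(2−1/n)} · ‖φ‖_{ℓ^n} ≤ φ*(w) ≤ ‖φ‖_{ℓ^n}. -/
open scoped Classical
noncomputable section

/-- `Rk Fq k` is the quotient ring `R = A/t^k A` where `A = 𝔽_q[[t]]`. -/
abbrev Rk (Fq : Type) [Field Fq] (k : ℕ) : Type :=
  PowerSeries Fq ⧸ Ideal.span {(PowerSeries.X : PowerSeries Fq) ^ k}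

/-- The image of `t` in `R = A/t^k A`. -/
def tbar (Fq : Type) [Field Fq] (k : ℕ) : Rk Fq k :=
  Ideal.Quotient.mk _ PowerSeries.X

/-- The set `S^{n-1}(R) = R^n ∖ (tR)^n` of primitive vectors of `R^n`. -/
def primSet (Fq : Type) [Field Fq] (n k : ℕ) : Set (Fin n → Rk Fq k) :=
  {w | ¬ ∀ i, ∃ r : Rk Fq k, w i = tbar Fq k * r}

/-- The line in `R^n` through `b` in the direction of `w`. -/
def rline {Fq : Type} [Field Fq] {n k : ℕ} (b w : Fin n → Rk Fq k) :
    Set (Fin n → Rk Fq k) :=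
  {v | ∃ r : Rk Fq k, v = fun i => b i + r * w i}

/-- The discrete Kakeya maximal function
`φ*(w) = sup_{ℓ ∥ w} q^{-k} Σ_{v ∈ ℓ} |φ(v)|`. -/
def maxFn (Fq : Type) [Field Fq] [Fintype Fq] {n k : ℕ}
    (φ : (Fin n → Rk Fq k) → ℝ) (w : Fin n → Rk Fq k) : ℝ :=
  ⨆ b : Fin n → Rk Fq k,
    ((Fintype.card Fq : ℝ) ^ k)⁻¹ * ∑ᶠ v ∈ rline b w, |φ v|

/-- A truncated power series is determined by its first `k` coefficients. -/
lemma bijective_mk_truncated_series (Fq : Type) [Field Fq] (k : ℕ) :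
    Function.Bijective (fun a : Fin k → Fq =>
      (Ideal.Quotient.mk _ (PowerSeries.mk fun i => if h : i < k then a ⟨i, h⟩ else 0) :
        Rk Fq k)) := by
  constructor
  · intro a b hab
    have h := Ideal.mem_span_singleton.1 (Ideal.Quotient.eq.1 hab)
    rw [PowerSeries.X_pow_dvd_iff] at h
    ext i
    have hi := h i i.2
    simpa [sub_eq_zero] using hi
  · intro x
    obtain ⟨p, rfl⟩ := Ideal.Quotient.mk_surjective x
    refine ⟨fun i => PowerSeries.coeff i p, ?_⟩
    refine Ideal.Quotient.eq.2 (Ideal.mem_span_singleton.2 ?_)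
    rw [PowerSeries.X_pow_dvd_iff]
    intro m hm
    simp [hm]

instance finite_Rk (Fq : Type) [Field Fq] [Fintype Fq] (k : ℕ) : Finite (Rk Fq k) :=
  Finite.of_surjective _ (bijective_mk_truncated_series Fq k).2

lemma card_Rk (Fq : Type) [Field Fq] [Fintype Fq] (k : ℕ) [Fintype (Rk Fq k)] :
    Fintype.card (Rk Fq k) = Fintype.card Fq ^ k := by
  rw [← Fintype.card_of_bijective (bijective_mk_truncated_series Fq k)]
  simp

/-- A primitive vector has a unit coordinate. -/
lemma exists_isUnit_of_mem_primSet {Fq : Type} [Field Fq] {n k : ℕ} {w : Fin n → Rk Fq k}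
    (hw : w ∈ primSet Fq n k) : ∃ i, IsUnit (w i) := by
  obtain ⟨i, hi⟩ := not_forall.1 hw
  refine ⟨i, ?_⟩
  obtain ⟨p, hp⟩ := Ideal.Quotient.mk_surjective (w i)
  have hX : ¬ PowerSeries.X ∣ p := by
    rintro ⟨s, rfl⟩
    exact hi ⟨Ideal.Quotient.mk _ s, by rw [← hp, map_mul]; rfl⟩
  rw [PowerSeries.X_dvd_iff] at hX
  rw [← hp]
  exact (PowerSeries.isUnit_iff_constantCoeff.2 (isUnit_iff_ne_zero.2 hX)).map _

lemma injective_add_smul {Fq : Type} [Field Fq] {n k : ℕ} {w : Fin n → Rk Fq k}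
    (hw : w ∈ primSet Fq n k) (b : Fin n → Rk Fq k) :
    Function.Injective fun r : Rk Fq k => b + r • w := by
  obtain ⟨i, hi⟩ := exists_isUnit_of_mem_primSet hw
  intro r s hrs
  have h := congrFun hrs i
  simp only [Pi.add_apply, Pi.smul_apply, smul_eq_mul, add_right_inj] at h
  exact hi.mul_left_injective h

/-- Sums over a line in a primitive direction can be parametrized by the ring. -/
lemma finsum_mem_rline {Fq : Type} [Field Fq] {n k : ℕ} [Fintype (Rk Fq k)]
    {w : Fin n → Rk Fq k} (hw : w ∈ primSet Fq n k) (b : Fin n → Rk Fq k)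
    (f : (Fin n → Rk Fq k) → ℝ) :
    ∑ᶠ v ∈ rline b w, f v = ∑ r : Rk Fq k, f (b + r • w) := by
  have hline : rline b w = Set.range fun r : Rk Fq k => b + r • w := by
    ext v
    exact exists_congr fun r => eq_comm
  rw [hline, finsum_mem_range (injective_add_smul hw b), finsum_eq_sum_of_fintype]

lemma sum_pow_le_pow_sum_of_nonneg {ι : Type*} (s : Finset ι) {f : ι → ℝ}
    (hf : ∀ i ∈ s, 0 ≤ f i) {n : ℕ} (hn : 0 < n) :
    ∑ i ∈ s, f i ^ n ≤ (∑ i ∈ s, f i) ^ n := by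
  obtain ⟨m, rfl⟩ := Nat.exists_eq_succ_of_ne_zero hn.ne'
  simp only [Nat.succ_eq_add_one, pow_succ]
  rw [Finset.mul_sum]
  refine Finset.sum_le_sum fun i hi => ?_
  have := hf i hi
  have := Finset.single_le_sum hf hi
  gcongr

/-- Averaging over all translates recovers the full sum. -/
lemma sum_sum_add_smul {R M : Type*} [Ring R] [AddCommGroup M] [Module R M] [Fintype R]
    [Fintype M] (g : M → ℝ) (w : M) :
    ∑ b : M, ∑ r : R, g (b + r • w) = Fintype.card R * ∑ v : M, g v := by
  have h (r : R) : ∑ b : M, g (b + r • w) = ∑ v : M, g v :=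
    Equiv.sum_comp (Equiv.addRight (r • w)) g
  rw [Finset.sum_comm]
  simp [h]

/-- The average over a line is at most the `ℓ^n` norm. -/
lemma average_le_rpow_sum_pow {R M : Type*} [Ring R] [AddCommGroup M] [Module R M]
    [Fintype R] [Fintype M] {n : ℕ} (hn : 0 < n) (φ : M → ℝ) (b w : M)
    (hinj : Function.Injective fun r : R => b + r • w) :
    (Fintype.card R : ℝ)⁻¹ * ∑ r : R, |φ (b + r • w)| ≤ (∑ v, |φ v| ^ n) ^ ((n : ℝ)⁻¹) := by
  have hQ : (1 : ℝ) ≤ Fintype.card R := by exact_mod_cast Fintype.card_pos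
  have hQ0 : (Fintype.card R : ℝ) ≠ 0 := by positivity
  refine (Real.le_rpow_inv_iff_of_pos (by positivity) (by positivity) (by positivity)).2 ?_
  rw [Real.rpow_natCast]
  calc ((Fintype.card R : ℝ)⁻¹ * ∑ r : R, |φ (b + r • w)|) ^ n
      = (∑ r : R, (Fintype.card R : ℝ)⁻¹ * |φ (b + r • w)|) ^ n := by rw [Finset.mul_sum]
    _ ≤ ∑ r : R, (Fintype.card R : ℝ)⁻¹ * |φ (b + r • w)| ^ n :=
        Real.pow_arith_mean_le_arith_mean_pow _ _ _ (fun _ _ => by positivity)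
          (by simp [hQ0]) (fun _ _ => abs_nonneg _) n
    _ ≤ ∑ r : R, |φ (b + r • w)| ^ n :=
        Finset.sum_le_sum fun r _ =>
          mul_le_of_le_one_left (by positivity) (inv_le_one_of_one_le₀ hQ)
    _ ≤ ∑ v, |φ v| ^ n := by
        exact (Finset.sum_map Finset.univ ⟨_, hinj⟩ (fun v => |φ v| ^ n)).symm.trans_le
          (Finset.sum_le_sum_of_subset_of_nonneg (Finset.subset_univ _)
            fun _ _ _ => by positivity)

/-- A bound for all line averages in a fixed direction bounds the `ℓ^n` norm. -/
lemma sum_pow_le_of_average_le {R M : Type*} [Ring R] [AddCommGroup M] [Module R M]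
    [Fintype R] [Fintype M] {n : ℕ} (hn : 0 < n) (φ : M → ℝ) (w : M) {c : ℝ}
    (hc : ∀ b, (Fintype.card R : ℝ)⁻¹ * ∑ r : R, |φ (b + r • w)| ≤ c) :
    Fintype.card R * ∑ v, |φ v| ^ n ≤ Fintype.card M * (Fintype.card R * c) ^ n := by
  have hQ : (0 : ℝ) < Fintype.card R := by exact_mod_cast Fintype.card_pos
  rw [← sum_sum_add_smul (fun v => |φ v| ^ n) w]
  calc ∑ b, ∑ r : R, |φ (b + r • w)| ^ n
      ≤ ∑ _b : M, (Fintype.card R * c) ^ n := by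
        refine Finset.sum_le_sum fun b _ =>
          (sum_pow_le_pow_sum_of_nonneg _ (fun _ _ => abs_nonneg _) hn).trans ?_
        exact pow_le_pow_left₀ (by positivity) ((inv_mul_le_iff₀ hQ).1 (hc b)) n
    _ = _ := by simp

/-- Pointwise bounds for the discrete Kakeya maximal function:
`q^{-k(2-1/n)}·‖φ‖_{ℓ^n} ≤ φ*(w) ≤ ‖φ‖_{ℓ^n}` for every primitive `w`. -/
theorem maxFn_pointwise_bounds
    (Fq : Type) [Field Fq] [Fintype Fq] (n k : ℕ) (hn : 0 < n) (hk : 0 < k)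
    (φ : (Fin n → Rk Fq k) → ℝ) (w : Fin n → Rk Fq k)
    (hw : w ∈ primSet Fq n k) :
    (Fintype.card Fq : ℝ) ^ (-(k : ℝ) * (2 - 1 / (n : ℝ)))
        * (∑ᶠ v, |φ v| ^ n) ^ ((n : ℝ)⁻¹) ≤ maxFn Fq φ w ∧
      maxFn Fq φ w ≤ (∑ᶠ v, |φ v| ^ n) ^ ((n : ℝ)⁻¹) := by
  have : Fintype (Rk Fq k) := Fintype.ofFinite _
  have hcard : (Fintype.card (Rk Fq k) : ℝ) = (Fintype.card Fq : ℝ) ^ k := by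
    exact_mod_cast card_Rk Fq k
  have hq : (0 : ℝ) < Fintype.card Fq := by exact_mod_cast Fintype.card_pos
  have hn' : (n : ℝ) ≠ 0 := by exact_mod_cast hn.ne'
  have havg (b : Fin n → Rk Fq k) :
      ((Fintype.card Fq : ℝ) ^ k)⁻¹ * ∑ᶠ v ∈ rline b w, |φ v| =
        (Fintype.card (Rk Fq k) : ℝ)⁻¹ * ∑ r : Rk Fq k, |φ (b + r • w)| := by
    rw [hcard, finsum_mem_rline hw b fun v => |φ v|]
  have hle_max (b : Fin n → Rk Fq k) :
      (Fintype.card (Rk Fq k) : ℝ)⁻¹ * ∑ r : Rk Fq k, |φ (b + r • w)| ≤ maxFn Fq φ w :=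
    (havg b).symm.trans_le (le_ciSup (f := fun b : Fin n → Rk Fq k =>
      ((Fintype.card Fq : ℝ) ^ k)⁻¹ * ∑ᶠ v ∈ rline b w, |φ v|) (Set.finite_range _).bddAbove b)
  have hmax0 : 0 ≤ maxFn Fq φ w := le_trans (by positivity) (hle_max 0)
  rw [finsum_eq_sum_of_fintype]
  constructor
  · have h := sum_pow_le_of_average_le (R := Rk Fq k) (M := Fin n → Rk Fq k) hn φ w
      (c := maxFn Fq φ w) hle_max
    have hM : (Fintype.card (Fin n → Rk Fq k) : ℝ) = (Fintype.card (Rk Fq k) : ℝ) ^ n := by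
      simp
    rw [hM, hcard] at h
    have hle : ∑ v, |φ v| ^ n ≤ ((Fintype.card Fq : ℝ) ^ ((k : ℝ) * (2 - 1 / n)) *
        maxFn Fq φ w) ^ n := by
      refine le_of_mul_le_mul_left (h.trans_eq ?_) (pow_pos hq k)
      rw [mul_pow, mul_pow, ← Real.rpow_mul_natCast hq.le, ← mul_assoc, ← mul_assoc]
      congr 1
      simp only [← Real.rpow_natCast, ← Real.rpow_mul hq.le, ← Real.rpow_add hq]
      congr 1
      field_simp
      ring
    rw [neg_mul, Real.rpow_neg hq.le, inv_mul_le_iff₀ (by positivity)]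
    exact (Real.rpow_inv_le_iff_of_pos (by positivity) (by positivity) (by positivity)).2
      (by rwa [Real.rpow_natCast])
  · exact ciSup_le fun b => (havg b).trans_le <|
      average_le_rpow_sum_pow (R := Rk Fq k) (M := Fin n → Rk Fq k) hn φ b w
        (injective_add_smul hw b)
end
end

section
/- Let q be a prime power, let k > d ≥ 1 be integers, and let α ≥ 1 be an integer. Let L′ ⊆ A_k be a set with exactly α + 1 elements such that no two distinct elements of L′ are congruent modulo t^{k−d}. Then for every u_0 ∈ L′, the sum Σ_{w ∈ L′∖{u_0}} q^{v_t(w−u_0)} is strictly less than (r + 1)·q^{k−d}, where r = ⌈log_q(α)⌉. -/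
open scoped Classical
noncomputable section

/-- A set of polynomials, pairwise incongruent modulo `X ^ m` and all congruent to `u` modulo
`X ^ j`, has at most `q ^ (m - j)` elements. -/
lemma card_le_pow_of_le_natTrailingDegree_sub {F : Type*} [Field F] [Fintype F] (m j : ℕ)
    (S : Finset (Polynomial F)) (u : Polynomial F)
    (hS : ∀ a ∈ S, ∀ b ∈ S, a ≠ b → ¬ (Polynomial.X : Polynomial F) ^ m ∣ (a - b))
    (hj : ∀ a ∈ S, j ≤ (a - u).natTrailingDegree) :
    S.card ≤ Fintype.card F ^ (m - j) := by
  let f : Polynomial F → Fin (m - j) → F := fun a i => a.coeff (j + i)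
  have hf : Set.InjOn f S := by
    intro a ha b hb hab
    by_contra hne
    refine hS a ha b hb hne (Polynomial.X_pow_dvd_iff.2 fun n hn => ?_)
    by_cases hnj : n < j
    · have h₁ := Polynomial.coeff_eq_zero_of_lt_natTrailingDegree (hnj.trans_le (hj a ha))
      have h₂ := Polynomial.coeff_eq_zero_of_lt_natTrailingDegree (hnj.trans_le (hj b hb))
      rw [Polynomial.coeff_sub, sub_eq_zero] at h₁ h₂ ⊢
      rw [h₁, h₂]
    · have h := congrFun hab ⟨n - j, by omega⟩
      have hn' : j + (n - j) = n := by omega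
      simp only [f, hn'] at h
      rw [Polynomial.coeff_sub, h, sub_self]
  calc S.card ≤ (Finset.univ : Finset (Fin (m - j) → F)).card :=
        Finset.card_le_card_of_injOn f (fun _ _ => Finset.mem_coe.2 (Finset.mem_univ _)) hf
    _ = Fintype.card F ^ (m - j) := by simp

/-- **Valuation sum bound.** Let `k > d ≥ 1`, `α ≥ 1`, and let `L' ⊆ A_k` have
exactly `α + 1` elements, no two distinct ones congruent modulo `t^{k−d}`.
Then for every `u₀ ∈ L'`,
`Σ_{w ∈ L'∖{u₀}} q^{v_t(w−u₀)} < (⌈log_q α⌉ + 1)·q^{k−d}`. -/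
theorem sum_valuation_bound
    (Fq : Type) [Field Fq] [Fintype Fq] (k d α : ℕ)
    (hd : 1 ≤ d) (hdk : d < k) (hα : 1 ≤ α)
    (L : Finset (Polynomial Fq)) (hLcard : L.card = α + 1)
    (hLk : ∀ a ∈ L, a.degree < (k : ℕ))
    (hcong : ∀ a ∈ L, ∀ b ∈ L, a ≠ b →
      ¬ (Polynomial.X : Polynomial Fq) ^ (k - d) ∣ (a - b))
    (u₀ : Polynomial Fq) (hu₀ : u₀ ∈ L) :
    ∑ w ∈ L.erase u₀, Fintype.card Fq ^ (w - u₀).natTrailingDegree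
      < (Nat.clog (Fintype.card Fq) α + 1) * Fintype.card Fq ^ (k - d) := by
  set q := Fintype.card Fq
  set m := k - d with hm_def
  set r := Nat.clog q α
  set v : Polynomial Fq → ℕ := fun w => (w - u₀).natTrailingDegree
  have hq : 1 < q := Fintype.one_lt_card
  have hm : 0 < m := by omega
  have hαr : α ≤ q ^ r := Nat.le_pow_clog hq α
  have hvm : ∀ w ∈ L.erase u₀, v w < m := by
    intro w hw
    obtain ⟨hne, hwL⟩ := Finset.mem_erase.1 hw
    by_contra! h
    exact hcong w hwL u₀ hu₀ hne (Polynomial.X_pow_dvd_iff.2 fun n hn =>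
      Polynomial.coeff_eq_zero_of_lt_natTrailingDegree (hn.trans_le h))
  have hlevel : ∀ j < m, ∑ w ∈ L.erase u₀ with v w = j, q ^ v w ≤ q ^ m := by
    intro j hj
    have hcard : ((L.erase u₀).filter fun w => v w = j).card ≤ q ^ (m - j) := by
      refine card_le_pow_of_le_natTrailingDegree_sub m j _ u₀ (fun a ha b hb => ?_)
        fun a ha => (Finset.mem_filter.1 ha).2.ge
      exact hcong a (Finset.mem_of_mem_erase (Finset.mem_filter.1 ha).1)
        b (Finset.mem_of_mem_erase (Finset.mem_filter.1 hb).1)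
    calc ∑ w ∈ L.erase u₀ with v w = j, q ^ v w
        = ∑ w ∈ L.erase u₀ with v w = j, q ^ j :=
          Finset.sum_congr rfl fun w hw => by rw [(Finset.mem_filter.1 hw).2]
      _ ≤ q ^ (m - j) * q ^ j := by
          rw [Finset.sum_const, smul_eq_mul]
          gcongr
      _ = q ^ m := by rw [← pow_add, Nat.sub_add_cancel hj.le]
  have hhigh : ∑ w ∈ L.erase u₀ with m ≤ v w + r, q ^ v w ≤ r * q ^ m := by
    have hmaps : ∀ w ∈ (L.erase u₀).filter (fun w => m ≤ v w + r), v w ∈ Finset.Ico (m - r) m := by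
      intro w hw
      obtain ⟨hwL, hwr⟩ := Finset.mem_filter.1 hw
      have := hvm w hwL
      rw [Finset.mem_Ico]
      omega
    rw [← Finset.sum_fiberwise_of_maps_to hmaps]
    calc _ ≤ ∑ _j ∈ Finset.Ico (m - r) m, q ^ m := by
          refine Finset.sum_le_sum fun j hj => le_trans ?_ (hlevel j (Finset.mem_Ico.1 hj).2)
          exact Finset.sum_le_sum_of_subset
            (Finset.filter_subset_filter _ (Finset.filter_subset _ _))
      _ ≤ r * q ^ m := by
          rw [Finset.sum_const, smul_eq_mul, Nat.card_Ico]
          gcongr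
          omega
  have hlow : ∑ w ∈ L.erase u₀ with ¬ m ≤ v w + r, q ^ v w < q ^ m := by
    refine lt_of_le_of_lt ?_ (Nat.pow_lt_pow_right hq (Nat.sub_lt hm one_pos))
    refine Nat.le_of_mul_le_mul_left ?_ (pow_pos (zero_lt_one.trans hq) r)
    calc q ^ r * ∑ w ∈ L.erase u₀ with ¬ m ≤ v w + r, q ^ v w
        ≤ ∑ w ∈ L.erase u₀ with ¬ m ≤ v w + r, q ^ (m - 1) := by
          rw [Finset.mul_sum]
          refine Finset.sum_le_sum fun w hw => ?_
          have := (Finset.mem_filter.1 hw).2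
          rw [← pow_add]
          exact Nat.pow_le_pow_right hq.le (by omega)
      _ ≤ ∑ w ∈ L.erase u₀, q ^ (m - 1) :=
          Finset.sum_le_sum_of_subset (Finset.filter_subset _ _)
      _ = α * q ^ (m - 1) := by
          rw [Finset.sum_const, smul_eq_mul, Finset.card_erase_of_mem hu₀, hLcard,
            Nat.add_sub_cancel]
      _ ≤ q ^ r * q ^ (m - 1) := by gcongr
  rw [← Finset.sum_filter_add_sum_filter_not _ (fun w => m ≤ v w + r), add_mul, one_mul]
  exact add_lt_add_of_le_of_lt hhigh hlow
end
end

section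
/- Let q be a prime power, k > 0 an integer, and 0 < θ ≤ 1. Let f ∈ B[z] be a nonzero polynomial in one variable of degree α with 1 ≤ α < q^k and leading coefficient c_α ∈ B. Then the number of elements u ∈ A_k such that v_X(f(s_u)) ≥ v_X(c_α) + θq^k (where the condition is also counted as satisfied if f(s_u) = 0) is strictly less than αqk/θ. -/
open scoped Classical
noncomputable section

/-- For `a = a_0 + a_1 t + ⋯ + a_{k-1} t^{k-1}`, the associated polynomial
`s_a = Σ_{j<k} a_j X^{q^j} ∈ 𝔽_q[X]`. -/
def sMap (Fq : Type) [Field Fq] [Fintype Fq] (k : ℕ) (a : Polynomial Fq) :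
    Polynomial Fq :=
  ∑ j ∈ Finset.range k, Polynomial.C (a.coeff j) * Polynomial.X ^ (Fintype.card Fq ^ j)

open Polynomial in
/-- A greedy choice of interpolation nodes, in the manner of Bhargava's `p`-orderings: if `f` takes
values divisible by `p ^ M` at all points `s u` with `u ∈ U`, then `f` may be replaced by a
polynomial `g` with the same leading coefficient and degree dropped by `n`, at the cost of `n`
linear factors vanishing at suitable nodes. -/
theorem exists_subset_pow_dvd_eval_mul_prod {R ι : Type*} [CommRing R] [IsDomain R] {p : R}
    (hp : Prime p) (M : ℕ) (s : ι → R) (U : Finset ι) (f : R[X])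
    (hfU : ∀ u ∈ U, p ^ M ∣ f.eval (s u)) (n : ℕ) (hnU : n ≤ U.card) (hnf : n ≤ f.natDegree) :
    ∃ T ⊆ U, T.card = n ∧ ∃ g : R[X], g.natDegree + n = f.natDegree ∧
      g.leadingCoeff = f.leadingCoeff ∧
      ∀ u ∈ U, p ^ M ∣ g.eval (s u) * ∏ a ∈ T, (s u - s a) := by
  induction n with
  | zero => exact ⟨∅, by simp, by simp, f, by simp, rfl, by simpa using hfU⟩
  | succ n ih =>
    obtain ⟨T, hTU, hT, g, hgdeg, hglc, hg⟩ := ih (by omega) (by omega)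
    have hne : (U \ T).Nonempty := by
      rw [← Finset.card_pos, Finset.card_sdiff_of_subset hTU]
      omega
    obtain ⟨a, ha, hmin⟩ := Finset.exists_min_image (U \ T)
      (fun u => emultiplicity p (∏ b ∈ T, (s u - s b))) hne
    obtain ⟨haU, haT⟩ := Finset.mem_sdiff.mp ha
    have key : ∀ u ∈ U, p ^ M ∣ g.eval (s a) * ∏ b ∈ T, (s u - s b) := by
      intro u hu
      by_cases huT : u ∈ T
      · rw [Finset.prod_eq_zero huT (sub_self _), mul_zero]
        exact dvd_zero _
      · have h := hg a haU
        rw [pow_dvd_iff_le_emultiplicity, emultiplicity_mul hp] at h ⊢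
        exact h.trans (by gcongr; exact hmin u (Finset.mem_sdiff.mpr ⟨hu, huT⟩))
    refine ⟨insert a T, Finset.insert_subset haU hTU, by rw [Finset.card_insert_of_notMem haT, hT],
      g /ₘ (X - C (s a)), ?_, ?_, ?_⟩
    · rw [natDegree_divByMonic _ (monic_X_sub_C _), natDegree_X_sub_C]
      omega
    · rw [leadingCoeff_divByMonic_X_sub_C _ _ _, hglc]
      intro h
      have := natDegree_eq_zero_iff_degree_le_zero.mpr h.le
      omega
    · intro u hu
      have hdiv := congrArg (eval (s u)) (modByMonic_add_div g (X - C (s a)))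
      rw [modByMonic_X_sub_C_eq_C_eval] at hdiv
      simp only [eval_add, eval_mul, eval_sub, eval_X, eval_C] at hdiv
      rw [Finset.prod_insert haT]
      have h := dvd_sub (hg u hu) (key u hu)
      rw [← hdiv] at h
      convert h using 1
      ring

theorem Polynomial.natTrailingDegree_prod_of_ne_zero {R ι : Type*} [CommRing R] [IsDomain R]
    (s : Finset ι) (f : ι → Polynomial R) (hf : ∀ i ∈ s, f i ≠ 0) :
    (∏ i ∈ s, f i).natTrailingDegree = ∑ i ∈ s, (f i).natTrailingDegree := by
  induction s using Finset.induction_on with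
  | empty => simp
  | insert a s ha ih =>
    rw [Finset.prod_insert ha, Finset.sum_insert ha,
      natTrailingDegree_mul (hf a (by simp))
        (Finset.prod_ne_zero_iff.mpr fun i hi => hf i (by simp [hi])),
      ih fun i hi => hf i (by simp [hi])]

theorem Polynomial.X_pow_dvd_iff_le_natTrailingDegree {R : Type*} [CommRing R] {f : Polynomial R}
    (hf : f ≠ 0) {n : ℕ} : Polynomial.X ^ n ∣ f ↔ n ≤ f.natTrailingDegree := by
  rw [X_pow_dvd_iff]
  exact ⟨fun h => le_natTrailingDegree hf h,
    fun h d hd => coeff_eq_zero_of_lt_natTrailingDegree (hd.trans_le h)⟩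

theorem Polynomial.finite_degree_lt (F : Type*) [Field F] [Fintype F] (n : ℕ) :
    {w : Polynomial F | w.degree < n}.Finite := by
  have h : {w : Polynomial F | w.degree < n} = (Polynomial.degreeLT F n : Set (Polynomial F)) := by
    ext w
    simp [Polynomial.mem_degreeLT]
  rw [h]
  have : Finite (Polynomial.degreeLT F n) := Finite.of_equiv _ (degreeLTEquiv F n).symm.toEquiv
  exact Set.toFinite _

theorem Polynomial.ncard_degree_lt (F : Type*) [Field F] [Fintype F] (n : ℕ) :
    {w : Polynomial F | w.degree < n}.ncard = Fintype.card F ^ n := by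
  have h : {w : Polynomial F | w.degree < n} = (Polynomial.degreeLT F n : Set (Polynomial F)) := by
    ext w
    simp [Polynomial.mem_degreeLT]
  rw [h, ← Nat.card_coe_set_eq]
  exact (Nat.card_congr (degreeLTEquiv F n).toEquiv).trans (by simp)

theorem Polynomial.card_lt_of_natTrailingDegree_eq {F : Type*} [Field F] [Fintype F] {k m : ℕ}
    (hmk : m ≤ k) (W : Finset (Polynomial F))
    (hW : ∀ w ∈ W, w ≠ 0 ∧ w.degree < k ∧ w.natTrailingDegree = m) :
    W.card < Fintype.card F ^ (k - m) := by
  have h0 : (0 : Polynomial F) ∉ W := fun h => (hW 0 h).1 rfl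
  rw [← ncard_degree_lt, ← Nat.succ_le_iff, Nat.succ_eq_add_one,
    ← Finset.card_insert_of_notMem h0, ← Set.ncard_coe_finset]
  refine (Set.ncard_le_ncard
    (t := (fun v => X ^ m * v) '' {w : Polynomial F | w.degree < (k - m : ℕ)})
    ?_ ((finite_degree_lt F _).image _)).trans (Set.ncard_image_le (finite_degree_lt F _))
  intro w hw
  rcases Finset.mem_insert.mp (Finset.mem_coe.mp hw) with rfl | hw
  · exact ⟨0, by simp, by simp⟩
  · obtain ⟨hw0, hwk, hwm⟩ := hW w hw
    obtain ⟨v, rfl⟩ := (X_pow_dvd_iff_le_natTrailingDegree hw0).mpr hwm.ge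
    refine ⟨v, ?_, rfl⟩
    have hv : v ≠ 0 := right_ne_zero_of_mul hw0
    rw [← natDegree_lt_iff_degree_lt hw0, natDegree_X_pow_mul _ hv] at hwk
    rw [Set.mem_ofPred_eq, ← natDegree_lt_iff_degree_lt hv]
    omega

theorem Polynomial.sum_card_pow_natTrailingDegree_lt {F : Type*} [Field F] [Fintype F] {k : ℕ}
    (hk : 0 < k) (W : Finset (Polynomial F)) (hW : ∀ w ∈ W, w ≠ 0 ∧ w.degree < k) :
    ∑ w ∈ W, Fintype.card F ^ w.natTrailingDegree < k * Fintype.card F ^ k := by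
  have hmaps : ∀ w ∈ W, w.natTrailingDegree ∈ Finset.range k := fun w hw =>
    Finset.mem_range.mpr <| (natTrailingDegree_le_natDegree w).trans_lt <|
      (natDegree_lt_iff_degree_lt (hW w hw).1).mpr (hW w hw).2
  rw [← Finset.sum_fiberwise_of_maps_to hmaps]
  calc _ < ∑ m ∈ Finset.range k, Fintype.card F ^ k := by
        refine Finset.sum_lt_sum_of_nonempty ⟨0, by simpa using hk⟩ fun m hm => ?_
        have hmk : m ≤ k := (Finset.mem_range.mp hm).le
        rw [Finset.sum_congr rfl
          (g := fun _ => Fintype.card F ^ m) fun w hw => by rw [(Finset.mem_filter.mp hw).2],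
          Finset.sum_const, smul_eq_mul]
        calc _ < Fintype.card F ^ (k - m) * Fintype.card F ^ m := by
              refine Nat.mul_lt_mul_of_pos_right
                (card_lt_of_natTrailingDegree_eq hmk _ fun w hw => ?_)
                (pow_pos Fintype.card_pos m)
              obtain ⟨hwW, hwm⟩ := Finset.mem_filter.mp hw
              exact ⟨(hW w hwW).1, (hW w hwW).2, hwm⟩
          _ = _ := by rw [← pow_add, Nat.sub_add_cancel hmk]
    _ = _ := by simp

section sMap

variable {Fq : Type} [Field Fq] [Fintype Fq]

theorem sMap_sub (k : ℕ) (a b : Polynomial Fq) :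
    sMap Fq k (a - b) = sMap Fq k a - sMap Fq k b := by
  simp [sMap, sub_mul]

theorem coeff_sMap {k m : ℕ} (hm : m < k) (a : Polynomial Fq) :
    (sMap Fq k a).coeff (Fintype.card Fq ^ m) = a.coeff m := by
  have h : ∀ j, Fintype.card Fq ^ m = Fintype.card Fq ^ j ↔ m = j := fun j =>
    (Nat.pow_right_injective (Fintype.one_lt_card : 1 < Fintype.card Fq)).eq_iff
  simp [sMap, Polynomial.finsetSum_coeff, Polynomial.coeff_C_mul, Polynomial.coeff_X_pow, h, hm]

theorem coeff_sMap_natTrailingDegree_ne_zero {k : ℕ} {a : Polynomial Fq} (ha : a ≠ 0)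
    (hak : a.degree < k) :
    (sMap Fq k a).coeff (Fintype.card Fq ^ a.natTrailingDegree) ≠ 0 := by
  rw [coeff_sMap ((Polynomial.natTrailingDegree_le_natDegree a).trans_lt
    ((Polynomial.natDegree_lt_iff_degree_lt ha).mpr hak))]
  exact Polynomial.trailingCoeff_nonzero_iff_nonzero.mpr ha

theorem sMap_ne_zero {k : ℕ} {a : Polynomial Fq} (ha : a ≠ 0) (hak : a.degree < k) :
    sMap Fq k a ≠ 0 := by
  intro h
  simpa [h] using coeff_sMap_natTrailingDegree_ne_zero ha hak

theorem natTrailingDegree_sMap_le {k : ℕ} {a : Polynomial Fq} (ha : a ≠ 0) (hak : a.degree < k) :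
    (sMap Fq k a).natTrailingDegree ≤ Fintype.card Fq ^ a.natTrailingDegree :=
  Polynomial.natTrailingDegree_le_of_ne_zero (coeff_sMap_natTrailingDegree_ne_zero ha hak)

/-- If `X ^ M` divides `f(s_u)` for all `u ∈ U`, then there are `deg f` nodes in `U` such that the
excess of `M` over the valuation of the leading coefficient is bounded, for every other `u ∈ U`, by
the total closeness of `u` to the nodes. -/
theorem exists_subset_le_natTrailingDegree_add_sum (k M : ℕ) (f : Polynomial (Polynomial Fq)) (hf : f ≠ 0)
    (U : Finset (Polynomial Fq)) (hU : ∀ u ∈ U, u.degree < k) (hcard : f.natDegree ≤ U.card)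
    (hM : ∀ u ∈ U, Polynomial.X ^ M ∣ f.eval (sMap Fq k u)) :
    ∃ T ⊆ U, T.card = f.natDegree ∧ ∀ u ∈ U \ T, M ≤ f.leadingCoeff.natTrailingDegree +
      ∑ a ∈ T, Fintype.card Fq ^ (u - a).natTrailingDegree := by
  obtain ⟨T, hTU, hT, g, hgdeg, hglc, hg⟩ := exists_subset_pow_dvd_eval_mul_prod
    Polynomial.prime_X M (sMap Fq k) U f hM _ hcard le_rfl
  refine ⟨T, hTU, hT, fun u hu => ?_⟩
  obtain ⟨huU, huT⟩ := Finset.mem_sdiff.mp hu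
  have hgC : g = Polynomial.C f.leadingCoeff := by
    rw [← hglc, Polynomial.leadingCoeff, show g.natDegree = 0 by omega]
    exact Polynomial.eq_C_of_natDegree_eq_zero (by omega)
  have hsub : ∀ a ∈ T, u - a ≠ 0 ∧ (u - a).degree < k := fun a ha =>
    ⟨sub_ne_zero.mpr fun h => huT (h ▸ ha),
      (Polynomial.degree_sub_le _ _).trans_lt (max_lt (hU u huU) (hU a (hTU ha)))⟩
  have hne : ∀ a ∈ T, sMap Fq k u - sMap Fq k a ≠ 0 := fun a ha => by
    rw [← sMap_sub]
    exact sMap_ne_zero (hsub a ha).1 (hsub a ha).2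
  have hc : f.leadingCoeff ≠ 0 := Polynomial.leadingCoeff_ne_zero.mpr hf
  have hprod := Finset.prod_ne_zero_iff.mpr hne
  have h := hg u huU
  rw [hgC, Polynomial.eval_C, Polynomial.X_pow_dvd_iff_le_natTrailingDegree (mul_ne_zero hc hprod),
    Polynomial.natTrailingDegree_mul hc hprod,
    Polynomial.natTrailingDegree_prod_of_ne_zero _ _ hne] at h
  refine h.trans (Nat.add_le_add_left (Finset.sum_le_sum fun a ha => ?_) _)
  rw [← sMap_sub]
  exact natTrailingDegree_sMap_le (hsub a ha).1 (hsub a ha).2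

end sMap

/-- **One-variable Schwartz–Zippel with valuations.** If `f ∈ B[z]` is nonzero
of degree `α`, `1 ≤ α < q^k`, with leading coefficient `c_α ∈ B = 𝔽_q[X]`, then
the number of `u ∈ A_k` with `v_X(f(s_u)) ≥ v_X(c_α) + θq^k` (counting also
those `u` with `f(s_u) = 0`) is strictly less than `αqk/θ`. -/
theorem one_variable_valuation_schwartz_zippel
    (Fq : Type) [Field Fq] [Fintype Fq] (k : ℕ) (hk : 0 < k)
    (θ : ℝ) (hθ0 : 0 < θ) (hθ1 : θ ≤ 1)
    (f : Polynomial (Polynomial Fq)) (hf : f ≠ 0) (α : ℕ)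
    (hα1 : 1 ≤ α) (hα2 : α < Fintype.card Fq ^ k) (hdeg : f.natDegree = α) :
    ({u : Polynomial Fq | u.degree < (k : ℕ) ∧
        (Polynomial.eval (sMap Fq k u) f = 0 ∨
          (f.leadingCoeff.natTrailingDegree : ℝ) + θ * (Fintype.card Fq : ℝ) ^ k
            ≤ ((Polynomial.eval (sMap Fq k u) f).natTrailingDegree : ℝ))}.ncard : ℝ)
      < (α : ℝ) * (Fintype.card Fq : ℝ) * (k : ℝ) / θ := by
  have hq : (2 : ℝ) ≤ Fintype.card Fq := by
    exact_mod_cast (Fintype.one_lt_card : 1 < Fintype.card Fq)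
  have hk1 : (1 : ℝ) ≤ k := by exact_mod_cast hk
  have hα : (1 : ℝ) ≤ α := by exact_mod_cast hα1
  have hqk : θ + k ≤ Fintype.card Fq * (k : ℝ) := by nlinarith
  have hQ : (0 : ℝ) < (Fintype.card Fq : ℝ) ^ k := by positivity
  rw [lt_div_iff₀ hθ0]
  set S : Set (Polynomial Fq) := {u | u.degree < (k : ℕ) ∧
    (Polynomial.eval (sMap Fq k u) f = 0 ∨
      (f.leadingCoeff.natTrailingDegree : ℝ) + θ * (Fintype.card Fq : ℝ) ^ k
        ≤ ((Polynomial.eval (sMap Fq k u) f).natTrailingDegree : ℝ))}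
  have hfin : S.Finite := (Polynomial.finite_degree_lt Fq k).subset fun u hu => hu.1
  obtain ⟨U, hU⟩ := hfin.exists_finset_coe
  rw [← hU, Set.ncard_coe_finset]
  have hmem : ∀ u ∈ U, u ∈ S := fun u hu => hU ▸ Finset.mem_coe.mpr hu
  suffices h : (U.card : ℝ) * θ < α * (θ + k) by nlinarith
  rcases le_or_gt U.card α with hle | hlt
  · have : (U.card : ℝ) ≤ α := by exact_mod_cast hle
    nlinarith
  set L := f.leadingCoeff.natTrailingDegree
  set M := ⌈(L : ℝ) + θ * (Fintype.card Fq : ℝ) ^ k⌉₊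
  obtain ⟨T, hTU, hT, hsum⟩ := exists_subset_le_natTrailingDegree_add_sum k M f hf U
    (fun u hu => (hmem u hu).1)
    (hdeg ▸ hlt.le) fun u hu => by
      by_cases h0 : Polynomial.eval (sMap Fq k u) f = 0
      · rw [h0]
        exact dvd_zero _
      · rw [Polynomial.X_pow_dvd_iff_le_natTrailingDegree h0]
        exact Nat.ceil_le.mpr ((hmem u hu).2.resolve_left h0)
  rw [hdeg] at hT
  have hlow : ∀ u ∈ U \ T, θ * (Fintype.card Fq : ℝ) ^ k ≤
      ∑ a ∈ T, (Fintype.card Fq : ℝ) ^ (u - a).natTrailingDegree := by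
    intro u hu
    have h1 : (M : ℝ) ≤ L + ∑ a ∈ T, (Fintype.card Fq : ℝ) ^ (u - a).natTrailingDegree := by
      exact_mod_cast hsum u hu
    have h2 : (L : ℝ) + θ * (Fintype.card Fq : ℝ) ^ k ≤ M := Nat.le_ceil _
    linarith
  have hup : ∀ a ∈ T, ∑ u ∈ U \ T, (Fintype.card Fq : ℝ) ^ (u - a).natTrailingDegree <
      k * (Fintype.card Fq : ℝ) ^ k := by
    intro a ha
    have h := Polynomial.sum_card_pow_natTrailingDegree_lt hk ((U \ T).image (· - a)) (by
      intro w hw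
      obtain ⟨u, hu, rfl⟩ := Finset.mem_image.mp hw
      obtain ⟨huU, huT⟩ := Finset.mem_sdiff.mp hu
      exact ⟨sub_ne_zero.mpr fun h => huT (h ▸ ha), (Polynomial.degree_sub_le _ _).trans_lt
        (max_lt (hmem u huU).1 (hmem a (hTU ha)).1)⟩)
    rw [Finset.sum_image fun u _ v _ h => sub_left_injective h] at h
    exact_mod_cast h
  have hTne : T.Nonempty := Finset.card_pos.mp (by omega)
  have hcardsub : ((U \ T).card : ℝ) = U.card - α := by
    rw [Finset.card_sdiff_of_subset hTU, hT, Nat.cast_sub hlt.le]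
  have h1 := Finset.sum_le_sum hlow
  rw [Finset.sum_comm] at h1
  have h2 := h1.trans_lt (Finset.sum_lt_sum_of_nonempty hTne hup)
  simp only [Finset.sum_const, nsmul_eq_mul, hcardsub, hT] at h2
  have h3 : ((U.card - α : ℝ) * θ) * (Fintype.card Fq : ℝ) ^ k <
      (α * k : ℝ) * (Fintype.card Fq : ℝ) ^ k := by linarith
  have h4 := lt_of_mul_lt_mul_right h3 hQ.le
  linarith
end
end
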